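/- For every natural number n, the balanced presentation with two generators x, y and the two relators y⁻¹(x⁻¹y)ⁿ(xy⁻¹)ⁿ and (yx⁻¹)ⁿ(y⁻¹x)ⁿy⁻¹x⁻¹ is AC-trivial. -/

import Mathlib

/-- Andrews-Curtis moves (1)-(4) on balanced presentations, where a balanced
presentation with `n` generators is a tuple of `n` relators in `FreeGroup (Fin n)`.
`inv` is move (1), `mul` is move (2), `conj`/`conjInv` are move (3) (conjugation by a
generator or its inverse), and `stab`/`destab` are the two directions of move (4). -/
inductive ACMove :
    (Σ n : ℕ, Fin n → FreeGroup (Fin n)) → (Σ n : ℕ, Fin n → FreeGroup (Fin n)) → Prop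
  | inv (n : ℕ) (r : Fin n → FreeGroup (Fin n)) (i : Fin n) :
      ACMove ⟨n, r⟩ ⟨n, Function.update r i (r i)⁻¹⟩
  | mul (n : ℕ) (r : Fin n → FreeGroup (Fin n)) (i j : Fin n) (hij : i ≠ j) :
      ACMove ⟨n, r⟩ ⟨n, Function.update r i (r i * r j)⟩
  | conj (n : ℕ) (r : Fin n → FreeGroup (Fin n)) (i j : Fin n) :
      ACMove ⟨n, r⟩ ⟨n, Function.update r i (FreeGroup.of j * r i * (FreeGroup.of j)⁻¹)⟩
  | conjInv (n : ℕ) (r : Fin n → FreeGroup (Fin n)) (i j : Fin n) :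
      ACMove ⟨n, r⟩ ⟨n, Function.update r i ((FreeGroup.of j)⁻¹ * r i * FreeGroup.of j)⟩
  | stab (n : ℕ) (r : Fin n → FreeGroup (Fin n)) :
      ACMove ⟨n, r⟩
        ⟨n + 1, Fin.snoc (fun i => FreeGroup.map Fin.castSucc (r i)) (FreeGroup.of (Fin.last n))⟩
  | destab (n : ℕ) (r : Fin n → FreeGroup (Fin n)) :
      ACMove
        ⟨n + 1, Fin.snoc (fun i => FreeGroup.map Fin.castSucc (r i)) (FreeGroup.of (Fin.last n))⟩
        ⟨n, r⟩

/-- Two balanced presentations are AC-equivalent if they are related by a finite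
sequence of Andrews-Curtis moves (1)-(4). -/
def ACEquiv (P Q : Σ n : ℕ, Fin n → FreeGroup (Fin n)) : Prop :=
  Relation.ReflTransGen ACMove P Q

/-- A balanced presentation is AC-trivial if it can be converted to the trivial
presentation `(x_1, …, x_n)` by a finite sequence of moves (1)-(4). -/
def ACTrivial {n : ℕ} (r : Fin n → FreeGroup (Fin n)) : Prop :=
  ACEquiv ⟨n, r⟩ ⟨n, fun i => FreeGroup.of i⟩

/-- The first generator `x` of the free group `F_2` on two generators. -/
def x : FreeGroup (Fin 2) := FreeGroup.of 0

/-- The second generator `y` of the free group `F_2` on two generators. -/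
def y : FreeGroup (Fin 2) := FreeGroup.of 1

theorem ac_conj {n : ℕ} (i : Fin n) (g : FreeGroup (Fin n)) :
    ∀ r : Fin n → FreeGroup (Fin n),
      ACEquiv ⟨n, r⟩ ⟨n, Function.update r i (g * r i * g⁻¹)⟩ := by
  induction g using FreeGroup.induction_on with
  | C1 => intro r; simpa [ACEquiv] using Relation.ReflTransGen.refl
  | of j => intro r; exact Relation.ReflTransGen.single (ACMove.conj n r i j)
  | inv_of j _ =>
    intro r
    have := Relation.ReflTransGen.single (ACMove.conjInv n r i j)
    simpa [ACEquiv] using this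
  | mul g h hg hh =>
    intro r
    have h2 := (hh r).trans (hg _)
    simpa [ACEquiv, mul_assoc] using h2

theorem ac_inv {n : ℕ} (i : Fin n) (r : Fin n → FreeGroup (Fin n)) :
    ACEquiv ⟨n, r⟩ ⟨n, Function.update r i (r i)⁻¹⟩ :=
  Relation.ReflTransGen.single (ACMove.inv n r i)

theorem ac_mulconj {n : ℕ} (i j : Fin n) (hij : i ≠ j) (g : FreeGroup (Fin n))
    (r : Fin n → FreeGroup (Fin n)) :
    ACEquiv ⟨n, r⟩ ⟨n, Function.update r i (r i * (g * r j * g⁻¹))⟩ := by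
  have h1 := ac_conj j g r
  have h2 := h1.trans (Relation.ReflTransGen.single (ACMove.mul n _ i j hij))
  have h3 := h2.trans (ac_conj j g⁻¹ _)
  convert (show ACEquiv _ _ from h3) using 2
  funext k
  by_cases hk : k = j
  · subst hk; simp [hij.symm, mul_assoc]
  · by_cases hi : k = i
    · subst hi; simp [hij]
    · simp [hk, hi]

theorem ac_mulconj_inv {n : ℕ} (i j : Fin n) (hij : i ≠ j) (g : FreeGroup (Fin n))
    (r : Fin n → FreeGroup (Fin n)) :
    ACEquiv ⟨n, r⟩ ⟨n, Function.update r i (r i * (g * r j * g⁻¹)⁻¹)⟩ := by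
  have h3 := ((ac_inv j r).trans (ac_mulconj i j hij g _)).trans (ac_inv j _)
  convert (show ACEquiv _ _ from h3) using 2
  funext k
  by_cases hk : k = j
  · subst hk; simp [hij.symm]
  · by_cases hi : k = i
    · subst hi; simp [hij, mul_assoc]
    · simp [hk, hi]

theorem ac_normal {n : ℕ} (i j : Fin n) (hij : i ≠ j) (r : Fin n → FreeGroup (Fin n))
    (h : FreeGroup (Fin n)) (hh : h ∈ Subgroup.normalClosure {r j}) :
    ∀ c, ACEquiv ⟨n, Function.update r i c⟩ ⟨n, Function.update r i (c * h)⟩ := by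
  unfold Subgroup.normalClosure at hh
  induction hh using Subgroup.closure_induction'' with
  | mem x hx =>
    intro c
    simp only [Group.mem_conjugatesOfSet_iff, Set.mem_singleton_iff, exists_eq_left,
      isConj_iff] at hx
    obtain ⟨g, rfl⟩ := hx
    simpa [hij.symm] using ac_mulconj i j hij g (Function.update r i c)
  | inv_mem x hx =>
    intro c
    simp only [Group.mem_conjugatesOfSet_iff, Set.mem_singleton_iff, exists_eq_left,
      isConj_iff] at hx
    obtain ⟨g, rfl⟩ := hx
    have := ac_mulconj_inv i j hij g (Function.update r i c)
    simpa only [Function.update_self, Function.update_of_ne hij.symm,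
      Function.update_idem] using this
  | one => intro c; simpa [ACEquiv] using Relation.ReflTransGen.refl
  | mul a b _ _ ha hb =>
    intro c
    rw [← mul_assoc]
    exact (ha c).trans (hb _)

theorem ac_left (a a' b : FreeGroup (Fin 2)) (h : a⁻¹ * a' ∈ Subgroup.normalClosure {b}) :
    ACEquiv ⟨2, ![a, b]⟩ ⟨2, ![a', b]⟩ := by
  have := ac_normal 0 1 (by decide) ![a, b] (a⁻¹ * a') (by simpa using h) a
  convert this using 2 <;> funext k <;> fin_cases k <;> simp

theorem ac_right (a b b' : FreeGroup (Fin 2)) (h : b⁻¹ * b' ∈ Subgroup.normalClosure {a}) :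
    ACEquiv ⟨2, ![a, b]⟩ ⟨2, ![a, b']⟩ := by
  have := ac_normal 1 0 (by decide) ![a, b] (b⁻¹ * b') (by simpa using h) b
  convert this using 2 <;> funext k <;> fin_cases k <;> simp

theorem ac_inv_right (a b : FreeGroup (Fin 2)) :
    ACEquiv ⟨2, ![a, b]⟩ ⟨2, ![a, b⁻¹]⟩ := by
  convert ac_inv 1 ![a, b] using 2
  funext k; fin_cases k <;> simp

theorem ac_inv_left (a b : FreeGroup (Fin 2)) :
    ACEquiv ⟨2, ![a, b]⟩ ⟨2, ![a⁻¹, b]⟩ := by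
  convert ac_inv 0 ![a, b] using 2
  funext k; fin_cases k <;> simp

theorem nc_iff (a b c : FreeGroup (Fin 2)) : a⁻¹ * b ∈ Subgroup.normalClosure {c} ↔
    (a : FreeGroup (Fin 2) ⧸ Subgroup.normalClosure {c}) = b := QuotientGroup.eq.symm

theorem nc_self (c : FreeGroup (Fin 2)) :
    (c : FreeGroup (Fin 2) ⧸ Subgroup.normalClosure {c}) = 1 :=
  (QuotientGroup.eq_one_iff c).2 (Subgroup.subset_normalClosure rfl)

theorem red {G : Type*} [Group G] (X Y : G) (n : ℕ) (h : X * Y * Y = 1) :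
    Y⁻¹ * (X⁻¹ * Y) ^ n * (X * Y⁻¹) ^ n = Y⁻¹ := by
  have hX : X = Y⁻¹ * Y⁻¹ := by
    rw [mul_assoc] at h
    rw [eq_inv_of_mul_eq_one_left h, mul_inv_rev]
  have e : X * Y⁻¹ = (X⁻¹ * Y)⁻¹ := by rw [hX]; group
  rw [e, inv_pow, mul_assoc, mul_inv_cancel, mul_one]

/-- Swap via moves: `(y⁻¹, x)` to `(x, y)`. -/
theorem ac_swap (a b : FreeGroup (Fin 2)) : ACEquiv ⟨2, ![a⁻¹, b]⟩ ⟨2, ![b, a]⟩ := by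
  have h1 := ac_left a⁻¹ (a⁻¹ * b) b (by
    rw [nc_iff, QuotientGroup.mk_mul, nc_self, mul_one])
  have h2 := ac_right (a⁻¹ * b) b a (by
    rw [nc_iff]; have := nc_self (a⁻¹ * b)
    rw [QuotientGroup.mk_mul, QuotientGroup.mk_inv, inv_mul_eq_one] at this
    exact this.symm)
  have h3 := ac_left (a⁻¹ * b) b a (by
    rw [nc_iff, QuotientGroup.mk_mul, QuotientGroup.mk_inv, nc_self, inv_one, one_mul])
  exact (h1.trans h2).trans h3

/-- The presentation with relators `y⁻¹(x⁻¹y)ⁿ(xy⁻¹)ⁿ` and `(yx⁻¹)ⁿ(y⁻¹x)ⁿy⁻¹x⁻¹` is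
AC-trivial for every natural number `n`. -/
theorem acTrivial_intermediate_4n1 (n : ℕ) :
    ACTrivial ![y⁻¹ * (x⁻¹ * y) ^ n * (x * y⁻¹) ^ n,
      (y * x⁻¹) ^ n * (y⁻¹ * x) ^ n * y⁻¹ * x⁻¹] := by
  have hE : (fun i => FreeGroup.of i : Fin 2 → FreeGroup (Fin 2)) = ![x, y] := by
    funext k; fin_cases k <;> rfl
  unfold ACTrivial
  rw [hE]
  have hb : ((y * x⁻¹) ^ n * (y⁻¹ * x) ^ n * y⁻¹ * x⁻¹)⁻¹ =
      x * y * y * (y⁻¹ * (x⁻¹ * y) ^ n * (x * y⁻¹) ^ n) := by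
    have e1 : (x⁻¹ * y) ^ n = ((y⁻¹ * x) ^ n)⁻¹ := by rw [← inv_pow]; simp
    have e2 : (x * y⁻¹) ^ n = ((y * x⁻¹) ^ n)⁻¹ := by rw [← inv_pow]; simp
    rw [e1, e2]; simp only [mul_inv_rev, inv_inv, mul_assoc, mul_inv_cancel_left]
  refine (ac_inv_right _ _).trans ?_
  rw [hb]
  refine (ac_right _ _ (x * y * y) ?_).trans ?_
  · rw [nc_iff, QuotientGroup.mk_mul _ (x * y * y), nc_self, mul_one]
  refine (ac_left _ y⁻¹ _ ?_).trans ?_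
  · rw [nc_iff]
    have := nc_self (x * y * y)
    simp only [QuotientGroup.mk_mul, QuotientGroup.mk_inv, QuotientGroup.mk_pow] at this ⊢
    exact red _ _ n this
  refine (ac_right _ _ x ?_).trans (ac_swap y x)
  rw [nc_iff]
  have := nc_self y⁻¹
  rw [QuotientGroup.mk_inv, inv_eq_one] at this
  rw [QuotientGroup.mk_mul, QuotientGroup.mk_mul, this, mul_one, mul_one]
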